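/- arXiv:math/0312509 — 3 statements merged into one kernel-verified Lean document; each statement's English description precedes it below -/
import Mathlib

section
/- Merzljakov's theorem: Let F be a nonabelian free group, k ≥ 1, X = (x₁,…,x_k), Y = (y₁,…,y_k), and let S(X,Y) ∈ F[X ∪ Y] be a word with constants from F. If the sentence ∀x₁∃y₁∀x₂∃y₂…∀x_k∃y_k (S(X,Y) = 1) is true in F, then there exist words q₁(x₁), q₂(x₁,x₂), …, q_k(x₁,…,x_k) with constants from F, where q_i ∈ F[x₁,…,x_i] depends only on the first i variables, such that S(x₁, q₁(x₁), x₂, q₂(x₁,x₂), …, x_k, q_k(x₁,…,x_k)) = 1 holds in the group F[X] = F ∗ F(X). -/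
open Monoid

universe u v w

namespace KM

variable {G : Type u} [Group G] {K : Type w} [Group K] {X : Type v}

/-- `G[X] = G ∗ F(X)`, the free product of `G` and the free group `F(X)` on the set of
variables `X`. -/
abbrev GX (G : Type u) [Group G] (X : Type v) : Type (max u v) :=
  Monoid.Coprod G (FreeGroup X)

/-- The embedding of the constants `G` into `G[X]`. -/
def const : G →* GX G X := Monoid.Coprod.inl

/-- The variable `x` as an element of `G[X]`. -/
def varg (x : X) : GX G X := Monoid.Coprod.inr (FreeGroup.of x)

/-- Evaluation of the words of `G[X]` in a `G`-group `K` (with structural morphism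
`μ : G →* K`) at a tuple `g : X → K`: the induced homomorphism `G[X] →* K` which is `μ` on
the constants and sends `x` to `g x`. -/
def evalIn (μ : G →* K) (g : X → K) : GX G X →* K :=
  Monoid.Coprod.lift μ (FreeGroup.lift g)

/-- Evaluation of the words of `G[X]` in `G` at a tuple `g : X → G`. -/
def eval (g : X → G) : GX G X →* G := evalIn (MonoidHom.id G) g

/-- `g : X → G` is a solution in `G` of the system of equations `S = 1` over `G`. -/
def IsSolution (S : Set (GX G X)) (g : X → G) : Prop := ∀ s ∈ S, eval g s = 1

/-- Substitution of the words `q i ∈ F[X]` for the variables `y_i`: the homomorphism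
`F[X ∪ Y] →* F[X]` which is the identity on the constants and on the variables `x_i`,
and sends `y_i` to `q i`. -/
def substY {F : Type u} [Group F] {k : ℕ} (q : Fin k → GX F (Fin k)) :
    GX F (Fin k ⊕ Fin k) →* GX F (Fin k) :=
  Monoid.Coprod.lift Monoid.Coprod.inl
    (FreeGroup.lift (Sum.elim (fun i => Monoid.Coprod.inr (FreeGroup.of i)) q))

/-- A set of words is a *comma-free code* if no nonempty suffix of one of its words is comparable,
in the prefix order, with one of its words, except for the trivial coincidences. -/
def IsCode {α : Type*} (T : Set (List (α × Bool))) : Prop :=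
  ∀ p ∈ T, ∀ q ∈ T, ∀ s, s ≠ [] → s <:+ q → (s <+: p ∨ p <+: s) → s = q ∧ p = q

/-- The word `p` straddles the junction of `u` and `v` in `u ++ v`. -/
def Straddles {α : Type*} (p u v : List α) : Prop :=
  ∃ a b, a ≠ [] ∧ b ≠ [] ∧ p = a ++ b ∧ a <:+ u ∧ b <+: v

section Code

variable {α : Type*} {T : Set (List (α × Bool))}

lemma IsCode.eq_of_comparable (hT : IsCode T) (hnil : [] ∉ T) {p q l : List (α × Bool)}
    (hp : p ∈ T) (hq : q ∈ T) (hpl : p <+: l) (hql : q <+: l) : p = q :=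
  (hT p hp q hq q (fun h => hnil (h ▸ hq)) List.suffix_rfl
    (List.prefix_or_prefix_of_prefix hql hpl)).2

/-- At most one word of a code straddles a given junction. -/
lemma IsCode.eq_of_straddles (hT : IsCode T) {p q u v : List (α × Bool)}
    (hp : p ∈ T) (hq : q ∈ T) (hpu : Straddles p u v) (hqu : Straddles q u v) : p = q := by
  obtain ⟨a, b, ha, hb, rfl, hau, hbv⟩ := hpu
  obtain ⟨a', b', ha', hb', rfl, hau', hbv'⟩ := hqu
  rcases List.suffix_or_suffix_of_suffix hau hau' with ⟨c, rfl⟩ | ⟨c, rfl⟩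
  · refine (hT _ hp _ hq (a ++ b') (by simp [ha]) ⟨c, by simp⟩ ?_).2
    simp only [List.prefix_append_right_inj]
    exact List.prefix_or_prefix_of_prefix hbv' hbv
  · refine (hT _ hq _ hp (a' ++ b) (by simp [ha']) ⟨c, by simp⟩ ?_).2.symm
    simp only [List.prefix_append_right_inj]
    exact List.prefix_or_prefix_of_prefix hbv hbv'

/-- No word of a code straddles a junction whose left part is a word of the code. -/
lemma IsCode.not_straddles (hT : IsCode T) {p q v : List (α × Bool)}
    (hp : p ∈ T) (hq : q ∈ T) : ¬ Straddles q p v := by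
  rintro ⟨a, b, ha, hb, rfl, hap, -⟩
  obtain ⟨rfl, h⟩ := hT _ hq _ hp a ha hap (Or.inl (List.prefix_append _ _))
  exact hb (List.append_right_eq_self.1 h)

/-- No word of a code straddles a junction whose right part is a word of the code. -/
lemma IsCode.not_straddles_right (hT : IsCode T) {p q v : List (α × Bool)}
    (hp : p ∈ T) (hq : q ∈ T) : ¬ Straddles q v p := by
  rintro ⟨a, b, ha, hb, rfl, -, hbp⟩
  have := (hT _ hp _ hq b hb (List.suffix_append _ _) (Or.inl hbp)).1
  exact ha (List.self_eq_append_left.1 this)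

end Code

section Replacement

open FreeGroup

variable {α H : Type*} [Group H] (ι : FreeGroup α →* H) (T : Set (List (α × Bool)))
  (τ : List (α × Bool) → H)

open Classical in
/-- The correction factor of a word starting with an element `p` of `T`, for replacing `p` by
`τ p`. -/
noncomputable def corr (l : List (α × Bool)) : H :=
  if h : ∃ p, p ∈ T ∧ p <+: l then τ h.choose * (ι (mk h.choose))⁻¹ else 1

/-- The value of a word in `H` after each occurrence of a subword `p ∈ T` has been replaced
by `τ p`. -/
noncomputable def repl : List (α × Bool) → H
  | [] => 1
  | x :: l => corr ι T τ (x :: l) * ι (mk [x]) * repl l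

/-- The data of a symmetric code `T` and of replacements compatible with inversion. -/
structure IsReplacement : Prop where
  code : IsCode T
  two_le : ∀ p ∈ T, 2 ≤ p.length
  inv_mem : ∀ p ∈ T, invRev p ∈ T
  map_inv : ∀ p ∈ T, τ (invRev p) = (τ p)⁻¹

variable {T τ}

lemma IsReplacement.nil_notMem (hT : IsReplacement T τ) : [] ∉ T := fun h => by
  simpa using hT.two_le _ h

lemma corr_eq_one {l : List (α × Bool)} (h : ∀ p ∈ T, ¬ p <+: l) : corr ι T τ l = 1 := by
  rw [corr, dif_neg]
  rintro ⟨p, hp, hpl⟩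
  exact h p hp hpl

lemma corr_eq_of_prefix_word (hT : IsReplacement T τ) {p l : List (α × Bool)} (hp : p ∈ T)
    (hpl : p <+: l) : corr ι T τ l = τ p * (ι (mk p))⁻¹ := by
  have h : ∃ p, p ∈ T ∧ p <+: l := ⟨p, hp, hpl⟩
  rw [corr, dif_pos h,
    hT.code.eq_of_comparable hT.nil_notMem h.choose_spec.1 hp h.choose_spec.2 hpl]

lemma corr_append (hT : IsReplacement T τ) {l v : List (α × Bool)} (hl : l ≠ [])
    (h : ∀ p ∈ T, ¬ Straddles p l v) : corr ι T τ (l ++ v) = corr ι T τ l := by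
  by_cases hp : ∃ p ∈ T, p <+: l
  · obtain ⟨p, hp, hpl⟩ := hp
    rw [corr_eq_of_prefix_word ι hT hp hpl,
      corr_eq_of_prefix_word ι hT hp (hpl.trans (List.prefix_append _ _))]
  · push Not at hp
    rw [corr_eq_one ι hp, corr_eq_one ι]
    intro p hpT hpl
    rcases List.prefix_or_prefix_of_prefix hpl (List.prefix_append l v) with h' | ⟨b, rfl⟩
    · exact hp p hpT h'
    · rw [List.prefix_append_right_inj] at hpl
      by_cases hb : b = []
      · subst hb
        exact hp _ hpT (by simp)
      · exact h _ hpT ⟨l, b, hl, hb, rfl, List.suffix_rfl, hpl⟩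

lemma repl_append (hT : IsReplacement T τ) {u v : List (α × Bool)}
    (h : ∀ p ∈ T, ¬ Straddles p u v) :
    repl ι T τ (u ++ v) = repl ι T τ u * repl ι T τ v := by
  induction u with
  | nil => simp [repl]
  | cons x u ih =>
    have h' : ∀ p ∈ T, ¬ Straddles p u v := by
      rintro p hp ⟨a, b, ha, hb, hab, hau, hbv⟩
      exact h p hp ⟨a, b, ha, hb, hab, hau.trans (List.suffix_cons _ _), hbv⟩
    have hc := corr_append ι hT (List.cons_ne_nil x u) h
    rw [List.cons_append] at hc ⊢
    rw [repl, repl, ih h', hc]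
    simp only [mul_assoc]

lemma repl_eq_of_forall_suffix {l : List (α × Bool)}
    (h : ∀ s, s <:+ l → ∀ p ∈ T, ¬ p <+: s) : repl ι T τ l = ι (mk l) := by
  induction l with
  | nil => simp [repl, ← one_eq_mk]
  | cons x l ih =>
    rw [repl, corr_eq_one ι (h _ List.suffix_rfl),
      ih fun s hs => h s (hs.trans (List.suffix_cons _ _)), one_mul, ← _root_.map_mul, mul_mk]
    simp

lemma repl_singleton (hT : IsReplacement T τ) (x : α × Bool) :
    repl ι T τ [x] = ι (mk [x]) := by
  refine repl_eq_of_forall_suffix ι fun s hs p hp hps => ?_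
  have h1 := hT.two_le p hp
  have h2 := hps.length_le
  have h3 := hs.length_le
  simp at h3
  omega

/-- The value of the replacement on a member of a code `T'` containing `T`. -/
lemma repl_of_mem (hT : IsReplacement T τ) {T' : Set (List (α × Bool))} (hTT' : T ⊆ T')
    (hT' : IsCode T') (hnil : [] ∉ T') {q : List (α × Bool)} (hq : q ∈ T') :
    (q ∈ T → repl ι T τ q = τ q) ∧ (q ∉ T → repl ι T τ q = ι (mk q)) := by
  cases q with
  | nil => exact absurd hq hnil
  | cons x l =>
    have hl : repl ι T τ l = ι (mk l) := by
      refine repl_eq_of_forall_suffix ι fun s hs p hp hps => ?_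
      have hs0 : s ≠ [] := by
        rintro rfl
        exact hT.nil_notMem (List.prefix_nil.1 hps ▸ hp)
      have := (hT' p (hTT' hp) _ hq s hs0 (hs.trans (List.suffix_cons _ _)) (Or.inr hps)).1
      have hlen := hs.length_le
      simp [this] at hlen
    have hmk : ι (mk [x]) * ι (mk l) = ι (mk (x :: l)) := by
      rw [← _root_.map_mul, mul_mk]; rfl
    refine ⟨fun h => ?_, fun h => ?_⟩
    · rw [repl, corr_eq_of_prefix_word ι hT h List.prefix_rfl, hl, mul_assoc, hmk, inv_mul_cancel_right]
    · rw [repl, corr_eq_one ι, hl, mul_assoc, hmk, one_mul]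
      intro p hp hpq
      exact h (hT'.eq_of_comparable hnil (hTT' hp) hq hpq List.prefix_rfl ▸ hp)

lemma repl_token (hT : IsReplacement T τ) {q : List (α × Bool)} (hq : q ∈ T) :
    repl ι T τ q = τ q :=
  (repl_of_mem ι hT subset_rfl hT.code hT.nil_notMem hq).1 hq

lemma invRev_prefix_iff {p q : List (α × Bool)} : invRev p <+: invRev q ↔ p <:+ q := by
  constructor
  · rintro ⟨t, ht⟩
    exact ⟨invRev t, invRev_injective (by rw [invRev_append, invRev_invRev, ht])⟩
  · rintro ⟨t, rfl⟩
    exact ⟨invRev t, by rw [invRev_append]⟩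

lemma invRev_suffix_iff {p q : List (α × Bool)} : invRev p <:+ invRev q ↔ p <+: q := by
  rw [← invRev_prefix_iff, invRev_invRev, invRev_invRev]

lemma repl_invRev (hT : IsReplacement T τ) (l : List (α × Bool)) :
    repl ι T τ (invRev l) = (repl ι T τ l)⁻¹ := by
  induction hn : l.length using Nat.strong_induction_on generalizing l with
  | _ n ih =>
    by_cases h : ∃ p ∈ T, p <+: l
    · obtain ⟨p, hp, v, rfl⟩ := h
      have hlen := hT.two_le p hp
      simp only [List.length_append] at hn
      rw [invRev_append, repl_append ι hT fun q hq => hT.code.not_straddles hp hq,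
        repl_append ι hT fun q hq => hT.code.not_straddles_right (hT.inv_mem p hp) hq,
        repl_token ι hT hp, repl_token ι hT (hT.inv_mem p hp), hT.map_inv p hp,
        ih v.length (by omega) v rfl, mul_inv_rev]
    · push Not at h
      cases l with
      | nil => simp [repl]
      | cons x l =>
        have hinv : invRev [x] = [(x.1, !x.2)] := by simp [invRev]
        rw [invRev_cons, repl_append ι hT, ih l.length (by simp [← hn]) l rfl, hinv,
          repl_singleton ι hT, repl, corr_eq_one ι h, one_mul, mul_inv_rev, ← _root_.map_inv, inv_mk,
          hinv]
        rintro p hp ⟨a, b, ha, hb, rfl, hal, hbx⟩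
        have hb' : b = invRev [x] := by
          rw [hinv, List.prefix_cons_iff] at hbx
          obtain rfl | ⟨t, rfl, ht⟩ := hbx
          · exact absurd rfl hb
          · rw [List.prefix_nil.1 ht, hinv]
        refine h _ (hT.inv_mem _ hp) ?_
        rw [hb', invRev_append, invRev_invRev, List.singleton_append, List.cons_prefix_cons]
        refine ⟨rfl, ?_⟩
        rw [← invRev_suffix_iff, invRev_invRev]
        exact hal

end Replacement

section Cancellation

open FreeGroup

variable {α : Type*}

lemma exists_cancellation {u v : List (α × Bool)} (hu : IsReduced u) (hv : IsReduced v) :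
    ∃ a b c, u = a ++ b ∧ v = invRev b ++ c ∧ IsReduced (a ++ c) := by
  induction u using List.reverseRecOn generalizing v with
  | nil => exact ⟨[], [], v, rfl, rfl, hv⟩
  | append_singleton u x ih =>
    cases v with
    | nil => exact ⟨u ++ [x], [], [], by simp, rfl, by simpa using hu⟩
    | cons y v =>
      by_cases hxy : x.1 = y.1 → x.2 = y.2
      · refine ⟨u ++ [x], [], y :: v, by simp, rfl, ?_⟩
        refine List.IsChain.append hu hv ?_
        simpa using hxy
      · push Not at hxy
        obtain ⟨a, b, c, rfl, rfl, h⟩ := ih (v := v) (List.IsChain.left_of_append hu)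
          (List.IsChain.tail hv)
        refine ⟨a, b ++ [x], c, by simp, ?_, h⟩
        have hy : y = (x.1, !x.2) := by
          refine Prod.ext hxy.1.symm ?_
          have := hxy.2
          cases hx : x.2 <;> cases hy : y.2 <;> simp_all
        simp [hy, invRev]

variable {H : Type*} [Group H] (ι : FreeGroup α →* H) [DecidableEq α]

/-- The replacement map is multiplicative on a given product, provided that the elements of `T`
avoid three junctions. -/
lemma exists_cuts_mul (g h : FreeGroup α) :
    ∃ C : List (List (α × Bool) × List (α × Bool)), C.length ≤ 3 ∧
      ∀ (T : Set (List (α × Bool))) (τ : List (α × Bool) → H), IsReplacement T τ →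
        (∀ c ∈ C, ∀ p ∈ T, ¬ Straddles p c.1 c.2) →
        repl ι T τ (g * h).toWord = repl ι T τ g.toWord * repl ι T τ h.toWord := by
  obtain ⟨a, b, c, hg, hh, hr⟩ :=
    exists_cancellation (isReduced_toWord (x := g)) (isReduced_toWord (x := h))
  refine ⟨[(a, c), (a, b), (invRev b, c)], by simp, fun T τ hT hC => ?_⟩
  have hgh : (g * h).toWord = a ++ c := by
    have : g * h = mk (a ++ c) := by
      rw [← mk_toWord (x := g), ← mk_toWord (x := h), hg, hh, ← mul_mk, ← mul_mk, ← mul_mk,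
        ← inv_mk]
      group
    rw [this, toWord_mk, hr.reduce_eq]
  simp only [List.mem_cons, List.not_mem_nil, or_false, forall_eq_or_imp, forall_eq] at hC
  rw [hgh, hg, hh, repl_append ι hT hC.1, repl_append ι hT hC.2.1, repl_append ι hT hC.2.2,
    repl_invRev ι hT]
  group

lemma exists_cuts_prod (gs : List (FreeGroup α)) :
    ∃ C : List (List (α × Bool) × List (α × Bool)), C.length ≤ 3 * gs.length ∧
      ∀ (T : Set (List (α × Bool))) (τ : List (α × Bool) → H), IsReplacement T τ →
        (∀ c ∈ C, ∀ p ∈ T, ¬ Straddles p c.1 c.2) →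
        repl ι T τ gs.prod.toWord = (gs.map fun g => repl ι T τ g.toWord).prod := by
  induction gs with
  | nil => exact ⟨[], by simp, fun T τ _ _ => by simp [repl]⟩
  | cons g gs ih =>
    obtain ⟨C, hC, hC'⟩ := ih
    obtain ⟨D, hD, hD'⟩ := exists_cuts_mul ι g gs.prod
    refine ⟨D ++ C, by simp; omega, fun T τ hT h => ?_⟩
    rw [List.prod_cons, hD' T τ hT fun c hc => h c (by simp [hc]),
      hC' T τ hT fun c hc => h c (by simp [hc]), List.map_cons, List.prod_cons]

end Cancellation

section Tokens

open FreeGroup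

variable {α : Type*} (a b : α)

/-- The word `a a b ^ (m + 1) a b`. -/
def token (m : ℕ) : List (α × Bool) :=
  (a, true) :: (a, true) :: (List.replicate (m + 1) (b, true) ++ [(a, true), (b, true)])

variable {a b}

lemma length_token (m : ℕ) : (token a b m).length = m + 5 := by
  simp [token]

lemma snd_of_mem_token {m : ℕ} {x : α × Bool} (hx : x ∈ token a b m) : x.2 = true := by
  simp only [token, List.mem_cons, List.mem_append, List.mem_replicate, List.not_mem_nil,
    or_false] at hx
  rcases hx with rfl | rfl | ⟨-, rfl⟩ | rfl | rfl <;> rfl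

lemma snd_of_mem_invRev_token {m : ℕ} {x : α × Bool} (hx : x ∈ invRev (token a b m)) :
    x.2 = false := by
  simp only [invRev, List.mem_reverse, List.mem_map] at hx
  obtain ⟨y, hy, rfl⟩ := hx
  simp [snd_of_mem_token hy]

lemma not_comparable_of_suffix (hab : a ≠ b) {n : ℕ} {s r : List (α × Bool)} (hs : s ≠ [])
    (h : s <:+ List.replicate n (b, true) ++ [(a, true), (b, true)]) :
    ¬ (s <+: (a, true) :: (a, true) :: r ∨ (a, true) :: (a, true) :: r <+: s) := by
  induction n with
  | zero =>
    simp only [List.replicate_zero, List.nil_append, List.suffix_cons_iff, List.suffix_nil] at h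
    rcases h with rfl | rfl | rfl
    · simp [hab, hab.symm]
    · simp [hab, hab.symm]
    · exact absurd rfl hs
  | succ n ih =>
    rw [List.replicate_succ, List.cons_append, List.suffix_cons_iff] at h
    rcases h with rfl | h
    · simp [hab, hab.symm]
    · exact ih h

lemma eq_of_replicate_prefix_word (hab : a ≠ b) {m n : ℕ}
    (h : List.replicate m (b, true) ++ [(a, true), (b, true)] <+:
      List.replicate n (b, true) ++ [(a, true), (b, true)]) : m = n := by
  induction m generalizing n with
  | zero =>
    cases n with
    | zero => rfl
    | succ n => simp [List.replicate_succ, hab] at h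
  | succ m ih =>
    cases n with
    | zero => simp [List.replicate_succ, hab.symm] at h
    | succ n =>
      simp only [List.replicate_succ, List.cons_append, List.cons_prefix_cons, true_and] at h
      rw [ih h]

lemma eq_of_token_prefix_word (hab : a ≠ b) {m n : ℕ} (h : token a b m <+: token a b n) : m = n := by
  simp only [token, List.cons_prefix_cons, true_and] at h
  exact Nat.succ_injective (eq_of_replicate_prefix_word hab h)

lemma token_injective (hab : a ≠ b) : Function.Injective (token a b) := fun _ _ h =>
  eq_of_token_prefix_word hab (h ▸ List.prefix_rfl)

lemma token_overlap (hab : a ≠ b) {m n : ℕ} {s : List (α × Bool)} (hs : s ≠ [])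
    (h : s <:+ token a b n) (h' : s <+: token a b m ∨ token a b m <+: s) :
    s = token a b n ∧ m = n := by
  rw [token, List.suffix_cons_iff, List.suffix_cons_iff] at h
  rcases h with rfl | rfl | h
  · refine ⟨rfl, ?_⟩
    rcases h' with h' | h'
    · exact (eq_of_token_prefix_word hab h').symm
    · exact eq_of_token_prefix_word hab h'
  · simp [token, List.replicate_succ, hab, hab.symm] at h'
  · exact absurd h' (not_comparable_of_suffix hab hs h)

variable (a b)

/-- All the tokens and their formal inverses. -/
def tokens : Set (List (α × Bool)) :=
  {p | ∃ m, p = token a b m ∨ p = invRev (token a b m)}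

variable {a b}

lemma token_mem_tokens (m : ℕ) : token a b m ∈ tokens a b := ⟨m, Or.inl rfl⟩

lemma invRev_token_mem_tokens (m : ℕ) : invRev (token a b m) ∈ tokens a b := ⟨m, Or.inr rfl⟩

lemma nil_notMem_tokens : [] ∉ tokens a b := by
  rintro ⟨m, h | h⟩ <;> simpa [length_token] using congrArg List.length h

lemma token_ne_invRev_token (m n : ℕ) : token a b m ≠ invRev (token a b n) := by
  intro h
  have h1 : (a, true) ∈ token a b m := by simp [token]
  exact Bool.noConfusion (snd_of_mem_invRev_token (h ▸ h1))

lemma not_comparable_of_snd {s p q : List (α × Bool)} {c : Bool} (hs : s ≠ []) (hp : p ≠ [])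
    (hsq : s <:+ q) (hqc : ∀ x ∈ q, x.2 = c) (hpc : ∀ x ∈ p, x.2 = !c) :
    ¬ (s <+: p ∨ p <+: s) := by
  rintro (h | h)
  · obtain ⟨x, hx⟩ := List.exists_mem_of_ne_nil s hs
    have h1 := hqc x (hsq.subset hx)
    rw [hpc x (h.subset hx)] at h1
    simp at h1
  · obtain ⟨x, hx⟩ := List.exists_mem_of_ne_nil p hp
    have h1 := hqc x (hsq.subset (h.subset hx))
    rw [hpc x hx] at h1
    simp at h1

lemma isCode_tokens (hab : a ≠ b) : IsCode (tokens a b) := by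
  intro p hp q hq s hs hsq hsp
  have hp0 : p ≠ [] := fun h => nil_notMem_tokens (h ▸ hp)
  obtain ⟨m, rfl | rfl⟩ := hp <;> obtain ⟨n, rfl | rfl⟩ := hq
  · obtain ⟨rfl, rfl⟩ := token_overlap hab hs hsq hsp
    exact ⟨rfl, rfl⟩
  · exact absurd hsp (not_comparable_of_snd hs hp0 hsq (fun x => snd_of_mem_invRev_token)
      fun x => snd_of_mem_token)
  · exact absurd hsp (not_comparable_of_snd hs hp0 hsq (fun x => snd_of_mem_token)
      fun x => snd_of_mem_invRev_token)
  · obtain ⟨s, rfl⟩ := invRev_surjective s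
    have hs' : s ≠ [] := by
      rintro rfl
      exact hs rfl
    rw [invRev_suffix_iff] at hsq
    rw [invRev_prefix_iff, invRev_prefix_iff] at hsp
    suffices s = token a b n ∧ m = n by
      obtain ⟨rfl, rfl⟩ := this
      exact ⟨rfl, rfl⟩
    rcases hsp with h | ⟨t, rfl⟩
    · obtain ⟨h1, h2⟩ := token_overlap hab hs' h (Or.inl hsq)
      exact ⟨h2 ▸ h1, h2.symm⟩
    · obtain ⟨r, hr⟩ := hsq
      have h1 := token_overlap hab (s := token a b m ++ r) (m := m) (n := n) (by simp [token])
        ⟨t, by simpa using hr⟩ (Or.inr (List.prefix_append _ _))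
      obtain ⟨h1, rfl⟩ := h1
      obtain rfl : r = [] := List.append_right_eq_self.1 h1
      exact ⟨by simpa using hr, rfl⟩

variable (a b) in
/-- The concatenation of the `N` consecutive tokens starting with the `M`-th one. -/
def block (N M : ℕ) : List (α × Bool) :=
  ((List.range N).map fun n => token a b (M + n)).flatten

lemma isReduced_block (N M : ℕ) : IsReduced (block a b N M) := by
  have h : ∀ x ∈ block a b N M, x.2 = true := by
    simp only [block, List.mem_flatten, List.mem_map]
    rintro x ⟨-, ⟨n, -, rfl⟩, hx⟩
    exact snd_of_mem_token hx
  refine (List.pairwise_of_forall_mem_list fun x hx y hy _ => ?_).isChain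
  rw [h x hx, h y hy]

/-- Among sufficiently many tokens, one does not straddle any of the given junctions. -/
lemma exists_not_straddles (hab : a ≠ b) (C : List (List (α × Bool) × List (α × Bool))) {N : ℕ}
    (hN : C.length < N) (M : ℕ) : ∃ n < N, ∀ c ∈ C, ¬ Straddles (token a b (M + n)) c.1 c.2 ∧
      ¬ Straddles (invRev (token a b (M + n))) c.1 c.2 := by
  classical
  by_contra! hcon
  have h : ∀ n < N, ∃ c ∈ C, ∃ p, (p = token a b (M + n) ∨ p = invRev (token a b (M + n))) ∧
      Straddles p c.1 c.2 := by
    intro n hn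
    obtain ⟨c, hc, h⟩ := hcon n hn
    by_cases hs : Straddles (token a b (M + n)) c.1 c.2
    · exact ⟨c, hc, _, Or.inl rfl, hs⟩
    · exact ⟨c, hc, _, Or.inr rfl, h hs⟩
  choose! c hc p hp hs using h
  obtain ⟨n, hn, n', hn', hne, heq⟩ := Finset.exists_ne_map_eq_of_card_lt_of_maps_to
    (s := Finset.range N) (t := C.toFinset) (f := c)
    (by simpa using (List.toFinset_card_le C).trans_lt hN)
    (fun n hn => by simpa using hc n (by simpa using hn))
  rw [Finset.mem_range] at hn hn'
  have hpp : p n = p n' := (isCode_tokens hab).eq_of_straddles ⟨_, hp n hn⟩ ⟨_, hp n' hn'⟩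
    (hs n hn) (heq ▸ hs n' hn')
  apply hne
  have key : M + n = M + n' := by
    rcases hp n hn with h | h <;> rcases hp n' hn' with h' | h'
    · exact token_injective hab (h ▸ hpp ▸ h')
    · exact absurd (h ▸ hpp ▸ h') (token_ne_invRev_token _ _)
    · exact absurd (h' ▸ hpp ▸ h) (token_ne_invRev_token _ _)
    · exact token_injective hab (invRev_injective (h ▸ hpp ▸ h'))
  omega

variable {H : Type*} [Group H] (ι : FreeGroup α →* H) {T : Set (List (α × Bool))}
  {τ : List (α × Bool) → H}

lemma repl_flatten_token (hab : a ≠ b) (hT : IsReplacement T τ) (hTt : T ⊆ tokens a b)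
    (l : List ℕ) : repl ι T τ (l.map (token a b)).flatten =
      (l.map fun m => repl ι T τ (token a b m)).prod := by
  induction l with
  | nil => simp [repl]
  | cons m l ih =>
    rw [List.map_cons, List.flatten_cons, repl_append ι hT, ih, List.map_cons, List.prod_cons]
    exact fun p hp => (isCode_tokens hab).not_straddles (token_mem_tokens m) (hTt hp)

lemma repl_flatten_token_of_notMem (hab : a ≠ b) (hT : IsReplacement T τ)
    (hTt : T ⊆ tokens a b) (l : List ℕ) (hl : ∀ m ∈ l, token a b m ∉ T) :
    repl ι T τ (l.map (token a b)).flatten = ι (mk (l.map (token a b)).flatten) := by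
  induction l with
  | nil => simp [repl, ← one_eq_mk]
  | cons m l ih =>
    rw [List.map_cons, List.flatten_cons, repl_append ι hT, ih fun m hm => hl m (by simp [hm]),
      (repl_of_mem ι hT hTt (isCode_tokens hab) nil_notMem_tokens (token_mem_tokens m)).2
      (hl m (by simp)), ← mul_mk, _root_.map_mul]
    exact fun p hp => (isCode_tokens hab).not_straddles (token_mem_tokens m) (hTt hp)

/-- If exactly one of the tokens of a block is replaced, then the replacement may be chosen so
that the block takes any prescribed value. -/
lemma exists_repl_block (hab : a ≠ b) {N n : ℕ} (hn : n < N) (M : ℕ) :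
    ∃ g h : FreeGroup α, ∀ (T : Set (List (α × Bool))) (τ : List (α × Bool) → H),
      IsReplacement T τ → T ⊆ tokens a b → token a b (M + n) ∈ T →
      (∀ n' < N, n' ≠ n → token a b (M + n') ∉ T) →
      repl ι T τ (block a b N M) = ι g * τ (token a b (M + n)) * ι h := by
  obtain ⟨s, t, hst⟩ := List.append_of_mem (List.mem_range.2 hn)
  have hnd : (s ++ n :: t).Nodup := hst ▸ List.nodup_range
  have hns : n ∉ s := fun h => by
    simpa using (List.nodup_append.1 hnd).2.2 n h n (by simp)
  have hnt : n ∉ t := (List.nodup_cons.1 (List.nodup_append.1 hnd).2.1).1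
  have hlt : ∀ m ∈ s ++ n :: t, m < N := fun m hm => List.mem_range.1 (hst ▸ hm)
  refine ⟨mk ((s.map (M + ·)).map (token a b)).flatten,
    mk ((t.map (M + ·)).map (token a b)).flatten, fun T τ hT hTt hnT hn' => ?_⟩
  have hblock : block a b N M =
      ((s.map (M + ·) ++ (M + n) :: t.map (M + ·)).map (token a b)).flatten := by
    rw [block, hst]
    simp [Function.comp_def]
  rw [hblock, repl_flatten_token ι hab hT hTt, List.map_append, List.prod_append, List.map_cons,
    List.prod_cons, ← repl_flatten_token ι hab hT hTt, ← repl_flatten_token ι hab hT hTt,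
    repl_flatten_token_of_notMem ι hab hT hTt, repl_flatten_token_of_notMem ι hab hT hTt,
    repl_token ι hT hnT, mul_assoc]
  · intro m hm
    obtain ⟨m, hm', rfl⟩ := List.mem_map.1 hm
    exact hn' m (hlt m (by simp [hm'])) fun h => hnt (h ▸ hm')
  · intro m hm
    obtain ⟨m, hm', rfl⟩ := List.mem_map.1 hm
    exact hn' m (hlt m (by simp [hm'])) fun h => hns (h ▸ hm')

lemma exists_isReplacement (hab : a ≠ b) {I : Type*} {m : I → ℕ} (hm : Function.Injective m)
    (t : I → H) : ∃ τ : List (α × Bool) → H,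
      (∀ i, τ (token a b (m i)) = t i) ∧ (∀ i, τ (invRev (token a b (m i))) = (t i)⁻¹) ∧
      IsReplacement {p | ∃ i, p = token a b (m i) ∨ p = invRev (token a b (m i))} τ := by
  classical
  let j : I ⊕ I → List (α × Bool) :=
    Sum.elim (fun i => token a b (m i)) (fun i => invRev (token a b (m i)))
  have hj : Function.Injective j := by
    refine ((token_injective hab).comp hm).sumElim
      (invRev_injective.comp ((token_injective hab).comp hm)) ?_
    exact fun i i' => token_ne_invRev_token _ _
  let τ : List (α × Bool) → H := Function.extend j (Sum.elim t fun i => (t i)⁻¹) 1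
  have h1 : ∀ i, τ (token a b (m i)) = t i := fun i => hj.extend_apply _ _ (Sum.inl i)
  have h2 : ∀ i, τ (invRev (token a b (m i))) = (t i)⁻¹ := fun i =>
    hj.extend_apply _ _ (Sum.inr i)
  refine ⟨τ, h1, h2, ?_, ?_, ?_, ?_⟩
  · rintro p ⟨i, hp⟩ q ⟨i', hq⟩
    exact isCode_tokens hab p ⟨_, hp⟩ q ⟨_, hq⟩
  · rintro p ⟨i, rfl | rfl⟩ <;> simp [length_token]
  · rintro p ⟨i, rfl | rfl⟩
    · exact ⟨i, Or.inr rfl⟩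
    · exact ⟨i, Or.inl invRev_invRev⟩
  · rintro p ⟨i, rfl | rfl⟩
    · rw [h1, h2]
    · rw [invRev_invRev, h1, h2, inv_inv]

end Tokens

section Generation

/-- The generators of `G[X]`: the images of the members of a family in `G`, and the variables. -/
def generators (G : Type*) [Group G] (X : Type*) {A : Type*} (c : A → G) : Set (GX G X) :=
  Set.range (fun a => const (c a)) ∪ Set.range varg

lemma closure_generators (A X : Type*) :
    Subgroup.closure (generators (FreeGroup A) X FreeGroup.of) = ⊤ := by
  have h1 : Set.range (fun a => (const (FreeGroup.of a) : GX (FreeGroup A) X)) =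
      const '' Set.range FreeGroup.of := Set.range_comp _ _
  have h2 : Set.range (varg : X → GX (FreeGroup A) X) =
      (Monoid.Coprod.inr : FreeGroup X →* GX (FreeGroup A) X) '' Set.range FreeGroup.of :=
    Set.range_comp _ _
  rw [generators, Subgroup.closure_union, h1, h2, ← MonoidHom.map_closure,
    ← MonoidHom.map_closure, FreeGroup.closure_range_of, FreeGroup.closure_range_of,
    ← MonoidHom.range_eq_map, ← MonoidHom.range_eq_map]
  exact Monoid.Coprod.range_inl_sup_range_inr

lemma exists_list_prod_eq {A X : Type*} (S : GX (FreeGroup A) X) :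
    ∃ l : List (GX (FreeGroup A) X),
      (∀ s ∈ l, s ∈ generators (FreeGroup A) X FreeGroup.of ∨
        s⁻¹ ∈ generators (FreeGroup A) X FreeGroup.of) ∧ l.prod = S := by
  have hS : S ∈ (Subgroup.closure (generators (FreeGroup A) X FreeGroup.of)).toSubmonoid := by
    rw [closure_generators]
    exact Subgroup.mem_top S
  rw [Subgroup.closure_toSubmonoid] at hS
  exact Submonoid.exists_list_of_mem_closure hS

lemma exists_forall_lt_of_dependsOn (B : ℕ → (ℕ → ℕ) → ℕ)
    (hB : ∀ j M M', (∀ i ≤ j, M i = M' i) → B j M = B j M') (k : ℕ) :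
    ∃ M : ℕ → ℕ, ∀ i < k, ∀ j < i, B j M < M i := by
  induction k with
  | zero => exact ⟨0, by simp⟩
  | succ k ih =>
    obtain ⟨M, hM⟩ := ih
    have hB' : ∀ c, ∀ j < k, B j (Function.update M k c) = B j M := fun c j hj =>
      hB j _ _ fun i hi => Function.update_of_ne (by omega) _ _
    refine ⟨Function.update M k ((Finset.range k).sup (fun j => B j M) + 1), fun i hi j hj => ?_⟩
    rw [hB' _ j (by omega)]
    rcases Nat.lt_succ_iff_lt_or_eq.1 hi with hi | rfl
    · rw [Function.update_of_ne hi.ne]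
      exact hM i hi j hj
    · rw [Function.update_self, Nat.lt_succ_iff]
      exact Finset.le_sup (f := fun j => B j M) (Finset.mem_range.2 hj)

variable {α H : Type*} [Group H] (ι : FreeGroup α →* H) {T : Set (List (α × Bool))}
  {τ : List (α × Bool) → H}

lemma repl_mem (P : Subgroup H) (hι : ∀ w, ι w ∈ P) (l : List (α × Bool))
    (h : ∀ p ∈ T, p.length ≤ l.length → τ p ∈ P) : repl ι T τ l ∈ P := by
  induction l with
  | nil => exact one_mem P
  | cons x l ih =>
    refine mul_mem (mul_mem ?_ (hι _)) (ih fun p hp hpl => h p hp (hpl.trans (by simp)))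
    rw [corr]
    split_ifs with hp
    · exact mul_mem (h _ hp.choose_spec.1 hp.choose_spec.2.length_le) (inv_mem (hι _))
    · exact one_mem P

end Generation

/-- Merzljakov's theorem.  Let `F` be a nonabelian free group and
`S(x₁,y₁,…,x_k,y_k) ∈ F[X ∪ Y]`.  If `∀x₁∃y₁…∀x_k∃y_k (S(X,Y) = 1)` is true in `F`
(expressed by Skolem functions `f_i : F^i → F`), then there are words
`q_i = q_i(x₁,…,x_i) ∈ F[x₁,…,x_i]` with constants from `F` such that
`S(x₁, q₁, …, x_k, q_k) = 1` holds in the group `F[X] = F ∗ F(X)`. -/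
theorem merzljakov {A : Type u} (hA : ∃ a b : A, a ≠ b) (k : ℕ) (hk : 1 ≤ k)
    (S : GX (FreeGroup A) (Fin k ⊕ Fin k))
    (hSkolem : ∃ f : (i : Fin k) → ((Fin (i.1 + 1) → FreeGroup A) → FreeGroup A),
      ∀ a : Fin k → FreeGroup A,
        eval (Sum.elim a (fun i => f i (fun j => a (Fin.castLE i.isLt j)))) S = 1) :
    ∃ q : Fin k → GX (FreeGroup A) (Fin k),
      (∀ i : Fin k, q i ∈ Subgroup.closure
        (Set.range (⇑(const : FreeGroup A →* GX (FreeGroup A) (Fin k))) ∪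
          (varg '' {j : Fin k | j ≤ i}))) ∧
      substY q S = 1 := by
  classical
  obtain ⟨a, b, hab⟩ := hA
  obtain ⟨f, hf⟩ := hSkolem
  obtain ⟨l, hl, rfl⟩ := exists_list_prod_eq S
  set N := 3 * l.length + 1
  let U : ℕ → FreeGroup A := fun M => FreeGroup.mk (block a b N M)
  have hU : ∀ M, (U M).toWord = block a b N M := fun M => by
    rw [FreeGroup.toWord_mk, (isReduced_block N M).reduce_eq]
  obtain ⟨M, hM⟩ := exists_forall_lt_of_dependsOn
    (fun j M => if h : j < k then
      (f ⟨j, h⟩ fun i => U (M i)).toWord.length + M j + N else 0) (by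
    intro j M M' h
    have hU' : (fun i : Fin (j + 1) => U (M i)) = fun i : Fin (j + 1) => U (M' i) :=
      funext fun i => by rw [h i (Nat.lt_succ_iff.1 i.isLt)]
    simp only [hU', h j le_rfl]) k
  let x : Fin k → FreeGroup A := fun i => U (M i)
  let y : Fin k → FreeGroup A := fun i => f i fun j => x (Fin.castLE i.isLt j)
  have hM' : ∀ i j : Fin k, j < i → (y j).toWord.length + M j + N < M i := fun i j hij => by
    have h := hM i i.isLt j hij
    simp only [j.isLt, dif_pos] at h
    exact h
  let ι : FreeGroup A →* GX (FreeGroup A) (Fin k) := const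
  obtain ⟨C, hC, hCprod⟩ := exists_cuts_prod ι (l.map (eval (Sum.elim x y)))
  rw [List.length_map] at hC
  choose n hn hnC using fun i : Fin k =>
    exists_not_straddles hab C (N := N) (by omega) (M i)
  have hlt : ∀ i j : Fin k, j < i → M j + N < M i + n i := fun i j hij => by
    have := hM' i j hij
    omega
  have hmono : StrictMono fun i : Fin k => M i + n i := fun j i hij => by
    have h1 := hlt i j hij
    have h2 := hn j
    show M j + n j < M i + n i
    omega
  choose g h hgh using fun i : Fin k => exists_repl_block ι hab (hn i) (M i)
  obtain ⟨τ, hτ, hτinv, hT⟩ := exists_isReplacement hab hmono.injective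
    fun i => (ι (g i))⁻¹ * varg i * (ι (h i))⁻¹
  set T : Set (List (A × Bool)) :=
    {p | ∃ i : Fin k, p = token a b (M i + n i) ∨ p = FreeGroup.invRev (token a b (M i + n i))}
  have hTt : T ⊆ tokens a b := fun p ⟨i, hp⟩ => ⟨_, hp⟩
  have hx : ∀ i, repl ι T τ (x i).toWord = varg i := by
    intro i
    rw [hU, hgh i T τ hT hTt ⟨i, Or.inl rfl⟩, hτ]
    · group
    · rintro n' hn' hne ⟨j, hj | hj⟩
      · have hj := token_injective hab hj
        rcases lt_trichotomy i j with hij | rfl | hij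
        · have := hM' j i hij
          omega
        · omega
        · have := hM' i j hij
          have := hn j
          omega
      · exact token_ne_invRev_token _ _ hj
  refine ⟨fun i => repl ι T τ (y i).toWord, fun i => ?_, ?_⟩
  · refine repl_mem ι _ (fun w => Subgroup.subset_closure (Or.inl ⟨_, rfl⟩)) _ ?_
    rintro p ⟨j, hp⟩ hlen
    have hji : j ≤ i := by
      by_contra! hij
      have := hM' j i hij
      rcases hp with rfl | rfl <;> simp [length_token] at hlen <;> omega
    have hτj : τ (token a b (M j + n j)) ∈ Subgroup.closure
        (Set.range (⇑(const : FreeGroup A →* GX (FreeGroup A) (Fin k))) ∪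
          (varg '' {j : Fin k | j ≤ i})) := by
      rw [hτ]
      have hι : ∀ w, ι w ∈ Subgroup.closure
          (Set.range (⇑(const : FreeGroup A →* GX (FreeGroup A) (Fin k))) ∪
            (varg '' {j : Fin k | j ≤ i})) :=
        fun w => Subgroup.subset_closure (Or.inl ⟨w, rfl⟩)
      exact mul_mem (mul_mem (inv_mem (hι _)) (Subgroup.subset_closure (Or.inr ⟨j, hji, rfl⟩)))
        (inv_mem (hι _))
    rcases hp with rfl | rfl
    · exact hτj
    · rw [hτinv, ← hτ]
      exact inv_mem hτj
  · have hgen : ∀ s ∈ generators (FreeGroup A) (Fin k ⊕ Fin k) FreeGroup.of,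
        repl ι T τ (eval (Sum.elim x y) s).toWord =
          substY (fun i => repl ι T τ (y i).toWord) s := by
      rintro s (⟨c, rfl⟩ | ⟨i | i, rfl⟩)
      · have h1 : eval (Sum.elim x y) (const (FreeGroup.of c)) = FreeGroup.of c := by
          simp [eval, evalIn, const]
        rw [h1, FreeGroup.toWord_of, repl_singleton ι hT]
        simp [ι, substY, const, FreeGroup.of]
      · have h1 : eval (Sum.elim x y) (varg (Sum.inl i)) = x i := by
          simp [eval, evalIn, varg]
        rw [h1, hx]
        simp [substY, varg]
      · have h1 : eval (Sum.elim x y) (varg (Sum.inr i)) = y i := by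
          simp [eval, evalIn, varg]
        rw [h1]
        simp [substY, varg]
    have hall : ∀ s ∈ l, repl ι T τ (eval (Sum.elim x y) s).toWord =
        substY (fun i => repl ι T τ (y i).toWord) s := by
      intro s hs
      rcases hl s hs with h | h
      · exact hgen s h
      · have := hgen _ h
        rwa [_root_.map_inv, _root_.map_inv, FreeGroup.toWord_inv, repl_invRev ι hT, inv_inj]
          at this
    have hprod := hCprod T τ hT (by
      rintro c hc p ⟨i, rfl | rfl⟩
      · exact (hnC i c hc).1
      · exact (hnC i c hc).2)
    rw [← map_list_prod, hf x, FreeGroup.toWord_one, repl, List.map_map] at hprod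
    rw [map_list_prod, hprod]
    congr 1
    exact List.map_congr_left fun s hs => (hall s hs).symm

end KM
end

section
/- Let F be a nonabelian free group, k, n ≥ 1, X = (x₁,…,x_k), Y = (y₁,…,y_k), and let U_i(X,Y), V_i(X,Y) ∈ F[X ∪ Y] (i = 1,…,n) be words with constants from F. Suppose the sentence ∀x₁∃y₁∀x₂∃y₂…∀x_k∃y_k ⋁_{i=1}^n (U_i(X,Y) = 1 ∧ V_i(X,Y) ≠ 1) is true in F. Then F freely lifts this sentence: there exist words q₁(x₁), q₂(x₁,x₂), …, q_k(x₁,…,x_k) with constants from F, where q_i ∈ F[x₁,…,x_i], and an index i ∈ {1,…,n} such that, in the group F[X] = F ∗ F(X), U_i(x₁, q₁, …, x_k, q_k) = 1 and V_i(x₁, q₁, …, x_k, q_k) ≠ 1. -/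
open Monoid

universe u v w

namespace KM

variable {G : Type u} [Group G] {K : Type w} [Group K] {X : Type v}

section SyllableMap

open Monoid.CoprodI

variable {ι : Type u} {M : ι → Type v} [∀ i, Group (M i)]

/-- The product of the images of the syllables of the normal form of `x`, where the images are
prescribed by an arbitrary function `φ` on syllables. -/
noncomputable def syllableMap {H : Type w} [Group H] (φ : (Σ i, M i) → H) (x : CoprodI M) : H :=
  open Classical in ((Word.equiv x).toList.map φ).prod

theorem syllableMap_prod {H : Type w} [Group H] (φ : (Σ i, M i) → H) (l : Word M) :
    syllableMap φ l.prod = (l.toList.map φ).prod := by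
  classical
  have h : Word.equiv l.prod = l := Word.equiv.apply_symm_apply l
  unfold syllableMap
  convert congrArg (fun l : Word M => (l.toList.map φ).prod) h

theorem exists_word_prod (x : CoprodI M) : ∃ l : Word M, l.prod = x := by
  classical
  exact ⟨Word.equiv x, Word.equiv.symm_apply_apply x⟩

/-- Multiplying two normal forms merges at most one pair of syllables. -/
theorem exists_word_merge [Nonempty ι] (l : List (Σ i, M i)) (w : Word M)
    (hne : ∀ x ∈ l, x.2 ≠ 1) (hc : l.reverse.IsChain fun x y => x.1 ≠ y.1) :
    ∃ w' : Word M, w'.prod = (l.reverse.map fun x => of x.2).prod * w.prod ∧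
      ∃ (i : ι) (g h : M i), ∀ (H : Type w) [Group H] (φ : (Σ i, M i) → H),
        (∀ i (g : M i), φ ⟨i, g⁻¹⟩ = (φ ⟨i, g⟩)⁻¹) →
        φ ⟨i, g * h⟩ = φ ⟨i, g⟩ * φ ⟨i, h⟩ →
        (w'.toList.map φ).prod = (l.reverse.map φ).prod * (w.toList.map φ).prod := by
  induction l generalizing w with
  | nil => exact ⟨w, by simp, Classical.arbitrary ι, 1, 1, by simp⟩
  | cons x l ih =>
    obtain ⟨i, g⟩ := x
    rw [List.reverse_cons, List.isChain_append] at hc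
    obtain ⟨hc₁, -, hc₂⟩ := hc
    have hne' : ∀ x ∈ l, x.2 ≠ 1 := fun x hx => hne x (List.mem_cons_of_mem _ hx)
    have hg : g ≠ 1 := hne ⟨i, g⟩ List.mem_cons_self
    by_cases hi : ∀ y ∈ w.toList.head?, i ≠ y.1
    · refine ⟨⟨l.reverse ++ ⟨i, g⟩ :: w.toList, ?_, ?_⟩, ?_, Classical.arbitrary ι, 1, 1, ?_⟩
      · intro y hy
        rcases List.mem_append.1 hy with hy | hy
        · exact hne' y (List.mem_reverse.1 hy)
        · rcases List.mem_cons.1 hy with rfl | hy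
          · exact hg
          · exact w.ne_one y hy
      · exact hc₁.append (List.isChain_cons.2 ⟨hi, w.chain_ne⟩) (by simpa using hc₂)
      · simp [Word.prod, mul_assoc]
      · simp [mul_assoc]
    · obtain ⟨lw, hlw, hcw⟩ := w
      push Not at hi
      obtain ⟨⟨j, h⟩, hy, rfl⟩ := hi
      cases lw with
      | nil => simp at hy
      | cons y lw =>
        obtain rfl : y = ⟨i, h⟩ := by simpa using hy
        have hcw' := List.isChain_cons.1 hcw
        have hlw' : ∀ x ∈ lw, x.2 ≠ 1 := fun x hx => hlw x (List.mem_cons_of_mem _ hx)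
        by_cases hgh : g * h = 1
        · obtain rfl : h = g⁻¹ := eq_inv_of_mul_eq_one_right hgh
          obtain ⟨w', hw', j, a, b, H⟩ := ih ⟨lw, hlw', hcw'.2⟩ hne' hc₁
          refine ⟨w', ?_, j, a, b, fun K _ φ hφ hab => ?_⟩
          · rw [hw']
            simp [Word.prod, mul_assoc]
          · rw [H K φ hφ hab]
            simp [mul_assoc, hφ]
        · refine ⟨⟨l.reverse ++ ⟨i, g * h⟩ :: lw, ?_, ?_⟩, ?_, i, g, h, ?_⟩
          · intro y hy
            rcases List.mem_append.1 hy with hy | hy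
            · exact hne' y (List.mem_reverse.1 hy)
            · rcases List.mem_cons.1 hy with rfl | hy
              · exact hgh
              · exact hlw' y hy
          · exact hc₁.append (List.isChain_cons.2 hcw') (by simpa using hc₂)
          · simp [Word.prod, mul_assoc]
          · intro K _ φ _ hab
            simp [mul_assoc, hab]

theorem syllableMap_mul [Nonempty ι] (x y : CoprodI M) :
    ∃ (i : ι) (g h : M i), ∀ (H : Type w) [Group H] (φ : (Σ i, M i) → H),
      (∀ i (g : M i), φ ⟨i, g⁻¹⟩ = (φ ⟨i, g⟩)⁻¹) →
      φ ⟨i, g * h⟩ = φ ⟨i, g⟩ * φ ⟨i, h⟩ →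
      syllableMap φ (x * y) = syllableMap φ x * syllableMap φ y := by
  obtain ⟨v, rfl⟩ := exists_word_prod x
  obtain ⟨w, rfl⟩ := exists_word_prod y
  obtain ⟨w', hw', i, g, h, H⟩ := exists_word_merge v.toList.reverse w
    (fun x hx => v.ne_one x (List.mem_reverse.1 hx)) (by simpa using v.chain_ne)
  refine ⟨i, g, h, fun K _ φ hφ hgh => ?_⟩
  have := H K φ hφ hgh
  rw [List.reverse_reverse] at hw' this
  rw [syllableMap_prod, syllableMap_prod, ← this, ← syllableMap_prod, hw', Word.prod]

end SyllableMap

section PowerSubstitution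

variable {A : Type u} {H : Type w} [Group H]

/-- The embedding of a free group into the free product of the cyclic groups generated by its
free generators. -/
def toCoprodI (A : Type u) : FreeGroup A →* CoprodI (fun _ : A => Multiplicative ℤ) :=
  FreeGroup.lift fun a => CoprodI.of (i := a) (Multiplicative.ofAdd 1)

open Classical in
/-- The image of a syllable `a ^ n` under the map which replaces `α ^ n` by `ψ n` for
`n : ℕ` and agrees with `μ` on the powers of the other generators. -/
noncomputable def powSyllable (μ : FreeGroup A →* H) (α : A) (ψ : ℕ → H)
    (s : Σ _ : A, Multiplicative ℤ) : H :=
  if s.1 = α then ψ s.2.toAdd.natAbs ^ s.2.toAdd.sign else μ (FreeGroup.of s.1) ^ s.2.toAdd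

/-- Replace every maximal power `α ^ n` or `α ^ (-n)` in the reduced form of `g` by `ψ n` or
`(ψ n)⁻¹`, and apply `μ` to the other letters. -/
noncomputable def powSubst (μ : FreeGroup A →* H) (α : A) (ψ : ℕ → H) (g : FreeGroup A) : H :=
  syllableMap (powSyllable μ α ψ) (toCoprodI A g)

variable (μ : FreeGroup A →* H) (α : A) (ψ : ℕ → H)

theorem powSyllable_inv (a : A) (n : Multiplicative ℤ) :
    powSyllable μ α ψ ⟨a, n⁻¹⟩ = (powSyllable μ α ψ ⟨a, n⟩)⁻¹ := by
  simp only [powSyllable]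
  split_ifs <;> simp [Int.sign_neg]

theorem powSyllable_eq {a : A} {n : Multiplicative ℤ}
    (h : ψ n.toAdd.natAbs = μ (FreeGroup.of α) ^ n.toAdd.natAbs) :
    powSyllable μ α ψ ⟨a, n⟩ = μ (FreeGroup.of a) ^ n.toAdd := by
  simp only [powSyllable]
  split_ifs with ha
  · rw [h, ← zpow_natCast, ← zpow_mul, mul_comm, Int.sign_mul_natAbs, ha]
  · rfl

/-- Away from at most three exponents depending on `g` and `h`, power substitution is
multiplicative on the pair `(g, h)`. -/
theorem powSubst_mul (α : A) (g h : FreeGroup A) :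
    ∃ T : Finset ℕ, T.card ≤ 3 ∧ ∀ (H : Type w) [Group H] (μ : FreeGroup A →* H) (ψ : ℕ → H),
      (∀ n ∈ T, ψ n = μ (FreeGroup.of α) ^ n) →
      powSubst μ α ψ (g * h) = powSubst μ α ψ g * powSubst μ α ψ h := by
  have : Nonempty A := ⟨α⟩
  obtain ⟨i, m, n, hmn⟩ := syllableMap_mul (toCoprodI A g) (toCoprodI A h)
  refine ⟨{m.toAdd.natAbs, n.toAdd.natAbs, (m * n).toAdd.natAbs}, Finset.card_le_three,
    fun H _ μ ψ hψ => ?_⟩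
  simp only [Finset.mem_insert, Finset.mem_singleton, forall_eq_or_imp, forall_eq] at hψ
  rw [powSubst, map_mul]
  refine hmn H _ (powSyllable_inv μ α ψ) ?_
  rw [powSyllable_eq μ α ψ hψ.1, powSyllable_eq μ α ψ hψ.2.1, powSyllable_eq μ α ψ hψ.2.2,
    toAdd_mul, zpow_add]

theorem map_eq_prod (μ : FreeGroup A →* H) (g : FreeGroup A)
    (w : CoprodI.Word fun _ : A => Multiplicative ℤ) (hw : w.prod = toCoprodI A g) :
    μ g = (w.toList.map fun s => μ (FreeGroup.of s.1) ^ s.2.toAdd).prod := by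
  let back : CoprodI (fun _ : A => Multiplicative ℤ) →* H :=
    CoprodI.lift fun a => zpowersHom H (μ (FreeGroup.of a))
  have hback : back.comp (toCoprodI A) = μ := by
    ext a
    simp [back, toCoprodI]
  have h : back (toCoprodI A g) = μ g := DFunLike.congr_fun hback g
  rw [← h, ← hw, CoprodI.Word.prod, map_list_prod, List.map_map]
  refine congrArg List.prod (List.map_congr_left fun s _ => ?_)
  simp [back]

theorem powSubst_eq_prod (g : FreeGroup A)
    (w : CoprodI.Word fun _ : A => Multiplicative ℤ) (hw : w.prod = toCoprodI A g) :
    powSubst μ α ψ g = (w.toList.map (powSyllable μ α ψ)).prod := by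
  rw [powSubst, ← hw, syllableMap_prod]

/-- Power substitution only sees finitely many exponents of a given element. -/
theorem exists_powSubst_bound (α : A) (g : FreeGroup A) :
    ∃ B : ℕ, ∀ (H : Type w) [Group H] (μ : FreeGroup A →* H) (ψ : ℕ → H),
      ((∀ n ≤ B, ψ n = μ (FreeGroup.of α) ^ n) → powSubst μ α ψ g = μ g) ∧
      ∀ K : Subgroup H, μ.range ≤ K → (∀ n ≤ B, ψ n ∈ K) → powSubst μ α ψ g ∈ K := by
  obtain ⟨w, hw⟩ := exists_word_prod (toCoprodI A g)
  refine ⟨(w.toList.map fun s => s.2.toAdd.natAbs).sum, fun H _ μ ψ => ⟨fun hψ => ?_, ?_⟩⟩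
  · rw [powSubst_eq_prod μ α ψ g w hw, map_eq_prod μ g w hw]
    congr 1
    refine List.map_congr_left fun s hs => powSyllable_eq μ α ψ (hψ _ ?_)
    exact List.single_le_sum (by simp) _ (List.mem_map_of_mem hs)
  · intro K hK hψ
    rw [powSubst_eq_prod μ α ψ g w hw]
    refine Subgroup.list_prod_mem _ fun x hx => ?_
    obtain ⟨s, hs, rfl⟩ := List.mem_map.1 hx
    simp only [powSyllable]
    split_ifs
    · exact K.zpow_mem (hψ _ (List.single_le_sum (by simp) _ (List.mem_map_of_mem hs))) _
    · exact K.zpow_mem (hK ⟨_, rfl⟩) _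

theorem powSubst_eq (h : ∀ n, ψ n = μ (FreeGroup.of α) ^ n) (g : FreeGroup A) :
    powSubst μ α ψ g = μ g :=
  (((exists_powSubst_bound α g).choose_spec H μ ψ).1) fun n _ => h n

theorem map_powSubst {H' : Type*} [Group H'] (θ : H →* H') (g : FreeGroup A) :
    θ (powSubst μ α ψ g) = powSubst (θ.comp μ) α (θ ∘ ψ) g := by
  rw [powSubst, powSubst, syllableMap, syllableMap, map_list_prod, List.map_map]
  congr 1
  refine List.map_congr_left fun s _ => ?_
  simp only [powSyllable, Function.comp_apply]
  split_ifs <;> simp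

/-- The element `∏ (β * α ^ r)`, with `r` running through a list of exponents. -/
def marker (α β : A) (l : List ℕ) : FreeGroup A :=
  (l.map fun r => FreeGroup.of β * FreeGroup.of α ^ r).prod

theorem marker_append (α β : A) (l l' : List ℕ) :
    marker α β (l ++ l') = marker α β l * marker α β l' := by
  simp [marker]

theorem powSubst_marker {α β : A} (hαβ : α ≠ β) (l : List ℕ) (hl : ∀ r ∈ l, 0 < r) :
    powSubst μ α ψ (marker α β l) = (l.map fun r => μ (FreeGroup.of β) * ψ r).prod := by
  let f : ℕ → List (Σ _ : A, Multiplicative ℤ) := fun r =>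
    [⟨β, Multiplicative.ofAdd 1⟩, ⟨α, Multiplicative.ofAdd (r : ℤ)⟩]
  have hchain : ((l.map f).flatten).IsChain fun x y => x.1 ≠ y.1 := by
    clear hl
    induction l with
    | nil => simp
    | cons r l ih =>
      rw [List.map_cons, List.flatten_cons]
      refine List.IsChain.append (by simp [f, hαβ.symm]) ih ?_
      cases l <;> simp [f, hαβ]
  let w : CoprodI.Word fun _ : A => Multiplicative ℤ :=
    ⟨(l.map f).flatten, by
      simp only [List.mem_flatten, List.mem_map]
      rintro s ⟨_, ⟨r, hr, rfl⟩, hs⟩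
      simp only [f, List.mem_cons, List.not_mem_nil, or_false] at hs
      have := hl r hr
      rcases hs with rfl | rfl
      · exact fun h => one_ne_zero (Multiplicative.ofAdd.injective h)
      · exact fun h => this.ne' (by exact_mod_cast Multiplicative.ofAdd.injective h), hchain⟩
  have hw : w.prod = toCoprodI A (marker α β l) := by
    simp only [CoprodI.Word.prod, w, marker, map_list_prod, List.map_map, List.map_flatten,
      List.prod_flatten]
    congr 1
    refine List.map_congr_left fun r _ => ?_
    have h : toCoprodI A (FreeGroup.of α ^ r) =
        CoprodI.of (M := fun _ : A => Multiplicative ℤ) (i := α)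
          (Multiplicative.ofAdd (r : ℤ)) := by
      rw [map_pow, toCoprodI, FreeGroup.lift_apply_of, ← map_pow, ← ofAdd_nsmul]
      simp
    simp [f, h]
    simp [toCoprodI]
  rw [powSubst_eq_prod μ α ψ _ w hw]
  simp only [w, List.map_flatten, List.map_map, List.prod_flatten]
  congr 1
  refine List.map_congr_left fun r hr => ?_
  have : (r : ℤ).sign = 1 := by simpa using hl r hr
  simp [f, powSyllable, hαβ.symm, this]

theorem powSubst_one : powSubst μ α ψ 1 = 1 := by
  rw [powSubst_eq_prod μ α ψ 1 CoprodI.Word.empty (by simp)]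
  simp [CoprodI.Word.empty]

/-- Away from a bounded number of exponents, power substitution commutes with the evaluation
of a given word. -/
theorem powSubst_eval {Y : Type v} (α : A) (u : GX (FreeGroup A) Y) :
    ∃ N B : ℕ, ∀ g : Y → FreeGroup A, ∃ T : Finset ℕ, T.card ≤ N ∧
      ∀ (H : Type w) [Group H] (μ : FreeGroup A →* H) (ψ : ℕ → H),
        (∀ n ≤ B, ψ n = μ (FreeGroup.of α) ^ n) → (∀ n ∈ T, ψ n = μ (FreeGroup.of α) ^ n) →
        powSubst μ α ψ (eval g u) = evalIn μ (fun y => powSubst μ α ψ (g y)) u := by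
  classical
  let P : GX (FreeGroup A) Y → Prop := fun u =>
    ∃ N B : ℕ, ∀ g : Y → FreeGroup A, ∃ T : Finset ℕ, T.card ≤ N ∧
      ∀ (H : Type w) [Group H] (μ : FreeGroup A →* H) (ψ : ℕ → H),
        (∀ n ≤ B, ψ n = μ (FreeGroup.of α) ^ n) → (∀ n ∈ T, ψ n = μ (FreeGroup.of α) ^ n) →
        powSubst μ α ψ (eval g u) = evalIn μ (fun y => powSubst μ α ψ (g y)) u
  have hmul : ∀ x y, P x → P y → P (x * y) := by
    rintro x y ⟨N, B, hx⟩ ⟨N', B', hy⟩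
    refine ⟨N + N' + 3, max B B', fun g => ?_⟩
    obtain ⟨T, hT, hx⟩ := hx g
    obtain ⟨T', hT', hy⟩ := hy g
    obtain ⟨T'', hT'', hxy⟩ := powSubst_mul α (eval g x) (eval g y)
    refine ⟨T ∪ T' ∪ T'', ?_, fun H _ μ ψ hB hψ => ?_⟩
    · have h₁ := Finset.card_union_le (T ∪ T') T''
      have h₂ := Finset.card_union_le T T'
      omega
    · simp only [Finset.mem_union] at hψ
      rw [map_mul, map_mul, hxy H μ ψ fun n hn => hψ n (Or.inr hn),
        hx H μ ψ (fun n hn => hB n (hn.trans (le_max_left _ _)))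
          fun n hn => hψ n (Or.inl (Or.inl hn)),
        hy H μ ψ (fun n hn => hB n (hn.trans (le_max_right _ _)))
          fun n hn => hψ n (Or.inl (Or.inr hn))]
  have hinv : ∀ x, P x → P x⁻¹ := by
    rintro x ⟨N, B, hx⟩
    refine ⟨N + 3, B, fun g => ?_⟩
    obtain ⟨T, hT, hx⟩ := hx g
    obtain ⟨T', hT', hxx⟩ := powSubst_mul α (eval g x) (eval g x)⁻¹
    refine ⟨T ∪ T', ?_, fun H _ μ ψ hB hψ => ?_⟩
    · have := Finset.card_union_le T T'
      omega
    · simp only [Finset.mem_union] at hψ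
      have h := hxx H μ ψ fun n hn => hψ n (Or.inr hn)
      rw [mul_inv_cancel, powSubst_one, hx H μ ψ hB fun n hn => hψ n (Or.inl hn)] at h
      rw [map_inv, map_inv, eq_inv_of_mul_eq_one_right h.symm]
  have hinl : ∀ c, P (Coprod.inl c) := fun c => by
    obtain ⟨B, hB⟩ := exists_powSubst_bound α c
    refine ⟨0, B, fun g => ⟨∅, le_rfl, fun H _ μ ψ hψ _ => ?_⟩⟩
    simpa [eval, evalIn] using (hB H μ ψ).1 hψ
  refine Coprod.induction_on (motive := P) u hinl (fun n => ?_) hmul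
  have hof : ∀ y, P (Coprod.inr (FreeGroup.of y)) := fun y =>
    ⟨0, 0, fun g => ⟨∅, le_rfl, fun H _ μ ψ _ _ => by simp [eval, evalIn]⟩⟩
  induction n using FreeGroup.induction_on with
  | C1 => simpa using hinl 1
  | of y => exact hof y
  | inv_of y _ => simpa using hinv _ (hof y)
  | mul x y hx hy => simpa using hmul _ _ hx hy

end PowerSubstitution

/-- A sequence each of whose terms exceeds a prescribed function of the preceding terms. -/
theorem exists_growing_sequence (b : ℕ) (Φ : ℕ → (ℕ → ℕ) → ℕ)
    (hΦ : ∀ i s s', (∀ m ≤ i, s m = s' m) → Φ i s = Φ i s') :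
    ∃ s : ℕ → ℕ, (∀ j, b < s j) ∧ ∀ i j, i < j → Φ i s < s j := by
  let step : (n : ℕ) → ((m : ℕ) → m < n → ℕ) → ℕ := fun n prev =>
    b + 1 + ∑ i ∈ Finset.range n, Φ i fun m => if h : m < n then prev m h else 0
  let s : ℕ → ℕ := (wellFounded_lt (α := ℕ)).fix step
  have hs : ∀ n, s n = b + 1 + ∑ i ∈ Finset.range n, Φ i s := fun n => by
    rw [show s n = step n fun m _ => s m from WellFounded.fix_eq _ _ _]
    simp only [step]
    congr 1
    refine Finset.sum_congr rfl fun i hi => hΦ _ _ _ fun m hm => ?_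
    rw [dif_pos (hm.trans_lt (Finset.mem_range.1 hi))]
  refine ⟨s, fun j => ?_, fun i j hij => ?_⟩
  · rw [hs]
    omega
  · rw [hs j]
    have := Finset.single_le_sum (f := fun i => Φ i s) (fun _ _ => Nat.zero_le _)
      (Finset.mem_range.2 hij)
    omega

/-- `F` freely lifts true sentences of the form
`∀x₁∃y₁…∀x_k∃y_k ⋁ᵢ (Uᵢ(X,Y) = 1 ∧ Vᵢ(X,Y) ≠ 1)`:  if such a sentence is true in the
nonabelian free group `F` (expressed by Skolem functions), then there are words
`q_i = q_i(x₁,…,x_i) ∈ F[x₁,…,x_i]` and an index `i` such that, in `F[X] = F ∗ F(X)`,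
`Uᵢ(x₁, q₁, …, x_k, q_k) = 1` and `Vᵢ(x₁, q₁, …, x_k, q_k) ≠ 1`. -/
theorem free_lift_of_true_sentence {A : Type u} (hA : ∃ a b : A, a ≠ b)
    (k n : ℕ) (hk : 1 ≤ k) (hn : 1 ≤ n)
    (U V : Fin n → GX (FreeGroup A) (Fin k ⊕ Fin k))
    (hSkolem : ∃ f : (i : Fin k) → ((Fin (i.1 + 1) → FreeGroup A) → FreeGroup A),
      ∀ a : Fin k → FreeGroup A, ∃ i : Fin n,
        eval (Sum.elim a (fun i' => f i' (fun j => a (Fin.castLE i'.isLt j)))) (U i) = 1 ∧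
        eval (Sum.elim a (fun i' => f i' (fun j => a (Fin.castLE i'.isLt j)))) (V i) ≠ 1) :
    ∃ q : Fin k → GX (FreeGroup A) (Fin k),
      (∀ i : Fin k, q i ∈ Subgroup.closure
        (Set.range (⇑(const : FreeGroup A →* GX (FreeGroup A) (Fin k))) ∪
          (varg '' {j : Fin k | j ≤ i}))) ∧
      ∃ i : Fin n, substY q (U i) = 1 ∧ substY q (V i) ≠ 1 := by
  classical
  obtain ⟨α, β, hαβ⟩ := hA
  obtain ⟨f, hf⟩ := hSkolem
  choose N B hNB using fun i => powSubst_eval.{u, 0, u} α (U i)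
  choose D hD using fun g : FreeGroup A => exists_powSubst_bound.{u, u} α g
  let L : ℕ → List ℕ := fun m => List.range' m (∑ i, N i + 1)
  let Φ : ℕ → (ℕ → ℕ) → ℕ := fun i s => s i + ∑ i, N i +
    if h : i < k then D (f ⟨i, h⟩ fun j => marker α β (L (s j))) else 0
  obtain ⟨s, hs₀, hs⟩ := exists_growing_sequence (∑ i, B i) Φ fun i s s' h => by
    have : (fun j : Fin (i + 1) => marker α β (L (s j))) =
        fun j : Fin (i + 1) => marker α β (L (s' j)) :=
      funext fun j => by rw [h j (Nat.le_of_lt_succ j.2)]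
    simp only [Φ, h i le_rfl, this]
  let a : Fin k → FreeGroup A := fun j => marker α β (L (s j))
  let b : Fin k → FreeGroup A := fun i => f i fun j => a (Fin.castLE i.isLt j)
  obtain ⟨i, hU, hV⟩ := hf a
  change eval (Sum.elim a b) (U i) = 1 at hU
  change eval (Sum.elim a b) (V i) ≠ 1 at hV
  obtain ⟨T, hT, hTU⟩ := hNB i (Sum.elim a b)
  have hr : ∀ j, ∃ r ∈ L (s j), r ∉ T := fun j => by
    by_contra! h
    have := Finset.card_le_card (s := (L (s j)).toFinset) (t := T)
      fun r hr => h r (List.mem_toFinset.1 hr)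
    rw [List.toFinset_card_of_nodup List.nodup_range', List.length_range'] at this
    have := Finset.single_le_sum (f := N) (fun _ _ => Nat.zero_le _) (Finset.mem_univ i)
    omega
  choose r hrL hrT using fun j : Fin k => hr j
  have hL : ∀ m n, n ∈ L m ↔ m ≤ n ∧ n < m + (∑ i, N i + 1) := fun m n => List.mem_range'_1
  have hsN : ∀ i j, i < j → s i + ∑ i, N i < s j := fun i j hij =>
    (Nat.le_add_right _ _).trans_lt (hs i j hij)
  have hsep : ∀ (i j : Fin k) (n : ℕ), n ∈ L (s i) → n ∈ L (s j) → i = j := by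
    intro i j n hi hj
    rw [hL] at hi hj
    rcases lt_trichotomy i j with h | h | h
    · have := hsN i j h
      omega
    · exact h
    · have := hsN j i h
      omega
  have hinj : Function.Injective r := fun i j hij => hsep i j (r i) (hrL i) (hij ▸ hrL j)
  choose l l' hl using fun j => List.append_of_mem (hrL j)
  let E : Fin k → GX (FreeGroup A) (Fin k) := fun j =>
    (const (marker α β (l j) * FreeGroup.of β))⁻¹ * varg j * (const (marker α β (l' j)))⁻¹
  let ψ : ℕ → GX (FreeGroup A) (Fin k) :=
    Function.extend r E fun n => const (FreeGroup.of α) ^ n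
  have hψr : ∀ j, ψ (r j) = E j := fun j => hinj.extend_apply _ _ _
  have hψ : ∀ n, (∀ j, r j ≠ n) → ψ n = const (FreeGroup.of α) ^ n := fun n hn =>
    Function.extend_apply' _ _ _ fun ⟨j, hj⟩ => hn j hj
  let ρ : FreeGroup A → GX (FreeGroup A) (Fin k) := powSubst const α ψ
  have hρa : ∀ j, ρ (a j) = varg j := fun j => by
    have hnd : (l j ++ r j :: l' j).Nodup := hl j ▸ List.nodup_range'
    have hconst : ∀ l₀ : List ℕ, (∀ n ∈ l₀, n ∈ L (s j) ∧ n ≠ r j) →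
        (l₀.map fun n => const (FreeGroup.of β) * ψ n).prod =
          (const (marker α β l₀) : GX (FreeGroup A) (Fin k)) := fun l₀ h => by
      rw [marker, map_list_prod, List.map_map]
      congr 1
      refine List.map_congr_left fun n hn => ?_
      rw [hψ n, Function.comp_apply, map_mul, map_pow]
      rintro i rfl
      exact (h _ hn).2 (congrArg r (hsep i j _ (hrL i) (h _ hn).1))
    have h₁ := hconst (l j) fun n hn => ⟨by rw [hl]; simp [hn], by
      rintro rfl
      exact List.disjoint_of_nodup_append hnd hn List.mem_cons_self⟩
    have h₂ := hconst (l' j) fun n hn => ⟨by rw [hl]; simp [hn], by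
      rintro rfl
      exact (List.nodup_cons.1 (List.nodup_append.1 hnd).2.1).1 hn⟩
    have hpos : ∀ n ∈ L (s j), 0 < n := fun n hn => by
      have := ((hL _ _).1 hn).1
      have := hs₀ j
      omega
    change powSubst const α ψ (marker α β (L (s j))) = _
    rw [powSubst_marker _ _ hαβ _ hpos, hl, List.map_append, List.prod_append, List.map_cons,
      List.prod_cons, h₁, h₂, hψr]
    simp only [E, map_mul]
    group
  refine ⟨fun j => ρ (b j), fun j => ?_, i, ?_, ?_⟩
  · refine (hD (b j) _ const ψ).2 _ ?_ fun n hn => ?_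
    · rintro _ ⟨c, rfl⟩
      exact Subgroup.subset_closure (Or.inl ⟨c, rfl⟩)
    · have hc : ∀ c, (const c : GX (FreeGroup A) (Fin k)) ∈ Subgroup.closure
          (Set.range (⇑(const : FreeGroup A →* GX (FreeGroup A) (Fin k))) ∪
            (varg '' {j' : Fin k | j' ≤ j})) := fun c =>
        Subgroup.subset_closure (Or.inl ⟨c, rfl⟩)
      by_cases h : ∃ j', r j' = n
      · obtain ⟨j', rfl⟩ := h
        have hj' : j' ≤ j := by
          by_contra! hlt
          have h₁ := hs j j' hlt
          have h₂ := ((hL _ _).1 (hrL j')).1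
          have h₃ : Φ j s = s j + ∑ i, N i + D (b j) := by
            simp only [Φ, dif_pos j.2]
            rfl
          omega
        rw [hψr]
        exact mul_mem (mul_mem (inv_mem (hc _))
          (Subgroup.subset_closure (Or.inr ⟨j', hj', rfl⟩))) (inv_mem (hc _))
      · push Not at h
        rw [hψ n h]
        exact pow_mem (hc _) n
  · have hB : ∀ n ≤ B i, ψ n = const (FreeGroup.of α) ^ n := fun n hn => hψ n fun j hj => by
      have h₁ := ((hL _ _).1 (hrL j)).1
      have h₂ := hs₀ j
      have h₃ := Finset.single_le_sum (f := B) (fun _ _ => Nat.zero_le _) (Finset.mem_univ i)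
      omega
    have hT' : ∀ n ∈ T, ψ n = const (FreeGroup.of α) ^ n := fun n hn => hψ n fun j hj =>
      hrT j (hj ▸ hn)
    have h := hTU _ const ψ hB hT'
    rw [hU, powSubst_one] at h
    rw [h]
    change evalIn const (Sum.elim varg fun j => ρ (b j)) (U i) = _
    congr 1
    congr 1
    funext y
    rcases y with j | j
    · exact (hρa j).symm
    · rfl
  · intro h
    apply hV
    let θ : GX (FreeGroup A) (Fin k) →* FreeGroup A := eval a
    have hθc : θ.comp const = MonoidHom.id _ := by
      ext
      simp [θ, eval, evalIn, const]
    have hθc' : ∀ c, θ (const c) = c := DFunLike.congr_fun hθc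
    have hθv : ∀ j, θ (varg j) = a j := fun j => by simp [θ, eval, evalIn, varg]
    have hθψ : ∀ n, (θ ∘ ψ) n = θ.comp const (FreeGroup.of α) ^ n := fun n => by
      rw [Function.comp_apply, hθc, MonoidHom.id_apply]
      by_cases h : ∃ j, r j = n
      · obtain ⟨j, rfl⟩ := h
        have ha : a j = marker α β (l j) * (FreeGroup.of β * FreeGroup.of α ^ r j) *
            marker α β (l' j) := by
          simp only [a, hl, marker_append, mul_assoc]
          simp [marker, mul_assoc]
        rw [hψr]
        simp only [E, map_mul, map_inv, hθc', hθv, ha]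
        group
      · push Not at h
        rw [hψ n h, map_pow, hθc']
    have hθρ : ∀ g, θ (ρ g) = g := fun g => by
      rw [map_powSubst, powSubst_eq _ _ _ hθψ, hθc, MonoidHom.id_apply]
    have hθ : θ.comp (substY fun j => ρ (b j)) = eval (Sum.elim a b) := by
      ext y
      · exact (hθc' (FreeGroup.of y)).trans (by simp [eval, evalIn])
      · rcases y with j | j
        · exact (hθv j).trans (by simp [eval, evalIn])
        · simp [substY, eval, evalIn, hθρ]
    rw [← hθ, MonoidHom.comp_apply, h, map_one]

end KM
end

section
/- Let G be a group and S(X) = 1 a system of equations over G having a solution in G, and let Y be a tuple of variables disjoint from X. Then a system T(X,Y) = 1 over G is compatible with S(X) = 1 over G if and only if both of the following hold: (a) the map X → G[X ∪ Y] induces an injective G-homomorphism λ* : G_{R(S)} → G_{R(S ∪ T)}, so that G_{R(S)} is canonically embedded into G_{R(S ∪ T)}; and (b) every G-homomorphism α : G_{R(S)} → G extends to a G-homomorphism α′ : G_{R(S ∪ T)} → G, i.e. α equals λ* followed by α′. -/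
open Monoid

universe u v w

namespace KM

variable {G : Type u} [Group G] {K : Type w} [Group K] {X : Type v}

/-- The radical `R(S)` of a system of equations `S = 1` over `G`: the set of all words
vanishing at every solution of `S = 1` in `G` (all of `G[X]` if there are no solutions). -/
def radical (S : Set (GX G X)) : Subgroup (GX G X) where
  carrier := {w | ∀ g : X → G, IsSolution S g → eval g w = 1}
  one_mem' := fun _ _ => map_one _
  mul_mem' := fun ha hb g hg => by rw [map_mul, ha g hg, hb g hg, one_mul]
  inv_mem' := fun ha g hg => by rw [map_inv, ha g hg, inv_one]

theorem mem_radical {S : Set (GX G X)} {w : GX G X} :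
    w ∈ radical S ↔ ∀ g : X → G, IsSolution S g → eval g w = 1 := Iff.rfl

instance radical_normal (S : Set (GX G X)) : (radical S).Normal := by
  constructor
  intro w hw g x hx
  have h1 : eval x w = 1 := hw x hx
  simp [map_mul, map_inv, h1]

/-- The coordinate group `G_{R(S)} = G[X]/R(S)` of the system `S = 1` over `G`. -/
abbrev CoordGroup (S : Set (GX G X)) : Type max u v := GX G X ⧸ radical S

/-- The canonical projection `G[X] → G_{R(S)}`. -/
def toCoord (S : Set (GX G X)) : GX G X →* CoordGroup S := QuotientGroup.mk' (radical S)

/-- The canonical map `μ : G → G_{R(S)}`. -/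
def coordConst (S : Set (GX G X)) : G →* CoordGroup S := (toCoord S).comp const

variable {Y : Type v}

/-- The canonical embedding `G[X] → G[X ∪ Y]`. -/
def inclL : GX G X →* GX G (X ⊕ Y) :=
  Monoid.Coprod.lift Monoid.Coprod.inl
    (FreeGroup.lift fun x => Monoid.Coprod.inr (FreeGroup.of (Sum.inl x)))

theorem eval_inclL (g : X ⊕ Y → G) (w : GX G X) :
    eval g (inclL (Y := Y) w) = eval (g ∘ Sum.inl) w := by
  have h : (eval g).comp (inclL (G := G) (X := X) (Y := Y)) = eval (g ∘ Sum.inl) := by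
    apply Monoid.Coprod.hom_ext
    · ext c
      simp [eval, evalIn, inclL]
    · ext x
      simp [eval, evalIn, inclL]
  exact DFunLike.congr_fun h w

/-- The canonical `G`-homomorphism `λ* : G_{R(S)} → G_{R(S ∪ T)}` induced by the map
`X → G[X ∪ Y]`. -/
def lamStar (S : Set (GX G X)) (T : Set (GX G (X ⊕ Y))) :
    CoordGroup S →* CoordGroup (⇑(inclL (Y := Y)) '' S ∪ T) :=
  QuotientGroup.map _ _ inclL (by
    intro w hw
    rw [Subgroup.mem_comap, mem_radical]
    intro g hg
    rw [eval_inclL]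
    refine hw (g ∘ Sum.inl) (fun s hs => ?_)
    have h := hg (inclL s) (Or.inl ⟨s, hs, rfl⟩)
    rwa [eval_inclL] at h)

/-- Substitution of the canonical images `X^μ ∈ G_{R(S)}` of the variables `X` (regarded
as constants) for `X`: the canonical homomorphism `G[X ∪ Y] → G_{R(S)}[Y]` sending a word
`T(X,Y)` to the word `T(X^μ,Y)` over `G_{R(S)}`. -/
def substMap (S : Set (GX G X)) : GX G (X ⊕ Y) →* GX (CoordGroup S) Y :=
  Monoid.Coprod.lift (Monoid.Coprod.inl.comp (coordConst S))
    (FreeGroup.lift (Sum.elim (fun x => Monoid.Coprod.inl ((toCoord S) (varg x)))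
      (fun y => Monoid.Coprod.inr (FreeGroup.of y))))

theorem eval_const (g : X → G) (c : G) : eval g (const c) = c := by
  simp [eval, evalIn, const]

theorem eval_varg (g : X → G) (x : X) : eval g (varg x) = g x := by
  simp [eval, evalIn, varg]

theorem mem_radical_of_mem {S : Set (GX G X)} {w : GX G X} (hw : w ∈ S) : w ∈ radical S :=
  fun _ hg => hg w hw

/-- A homomorphism `G[X] → G` which is the identity on `G` is the evaluation at the images of
the variables. -/
theorem eq_eval_of_comp_const (φ : GX G X →* G) (hφ : φ.comp const = MonoidHom.id G) :
    φ = eval fun x => φ (varg x) := by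
  refine Monoid.Coprod.hom_ext ?_ ?_
  · ext c
    exact (DFunLike.congr_fun hφ c).trans (eval_const (fun x => φ (varg x)) c).symm
  · ext x
    exact (eval_varg (fun x => φ (varg x)) x).symm

/-- The `G`-homomorphism `G_{R(S)} → G` given by evaluation at a solution of `S = 1`. -/
def coordEval (S : Set (GX G X)) (g : X → G) (hg : IsSolution S g) : CoordGroup S →* G :=
  QuotientGroup.lift (radical S) (eval g) fun _ hw => hw g hg

theorem coordEval_toCoord {S : Set (GX G X)} {g : X → G} (hg : IsSolution S g) (w : GX G X) :
    coordEval S g hg (toCoord S w) = eval g w := rfl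

theorem coordEval_comp_coordConst {S : Set (GX G X)} {g : X → G} (hg : IsSolution S g) :
    (coordEval S g hg).comp (coordConst S) = MonoidHom.id G :=
  MonoidHom.ext fun c => eval_const g c

theorem apply_toCoord {S : Set (GX G X)} (α : CoordGroup S →* G)
    (hα : α.comp (coordConst S) = MonoidHom.id G) (w : GX G X) :
    α (toCoord S w) = eval (fun x => α (toCoord S (varg x))) w :=
  DFunLike.congr_fun (eq_eval_of_comp_const (α.comp (toCoord S)) hα) w

/-- A `G`-homomorphism `G_{R(S)} → G` sends the variables to a solution of `S = 1`. -/
theorem isSolution_of_comp_coordConst {S : Set (GX G X)} (α : CoordGroup S →* G)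
    (hα : α.comp (coordConst S) = MonoidHom.id G) :
    IsSolution S fun x => α (toCoord S (varg x)) := by
  intro s hs
  have h : toCoord S s = 1 := (QuotientGroup.eq_one_iff s).2 (mem_radical_of_mem hs)
  rw [← apply_toCoord α hα, h, map_one]

theorem lamStar_toCoord (S : Set (GX G X)) (T : Set (GX G (X ⊕ Y))) (w : GX G X) :
    lamStar S T (toCoord S w) = toCoord _ (inclL w) := rfl

theorem inclL_varg (x : X) : inclL (G := G) (Y := Y) (varg x) = varg (Sum.inl x) := by
  simp [inclL, varg]

theorem isSolution_image_union {S : Set (GX G X)} {T : Set (GX G (X ⊕ Y))} {U : X → G} {B : Y → G}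
    (hU : IsSolution S U) (hB : ∀ t ∈ T, eval (Sum.elim U B) t = 1) :
    IsSolution (⇑(inclL (Y := Y)) '' S ∪ T) (Sum.elim U B) := by
  rintro _ (⟨s, hs, rfl⟩ | ht)
  · rw [eval_inclL, Sum.elim_comp_inl]
    exact hU s hs
  · exact hB _ ht

/-- A system `T(X,Y) = 1` is compatible with `S(X) = 1` over `G` (every solution of
`S = 1` in `G` extends to a solution of `T = 1` in `G`) if and only if (a) the canonical
`G`-homomorphism `λ* : G_{R(S)} → G_{R(S ∪ T)}` is injective, and (b) every
`G`-homomorphism `α : G_{R(S)} → G` factors through `λ*` by a `G`-homomorphism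
`α' : G_{R(S ∪ T)} → G`. -/
theorem compatible_iff_embeds_and_extends {G : Type u} [Group G] {X Y : Type v}
    (S : Set (GX G X)) (T : Set (GX G (X ⊕ Y)))
    (hS : ∃ U : X → G, IsSolution S U) :
    (∀ U : X → G, IsSolution S U →
        ∃ B : Y → G, ∀ t ∈ T, eval (Sum.elim U B) t = 1) ↔
      (Function.Injective (lamStar S T) ∧
        ∀ α : CoordGroup S →* G, α.comp (coordConst S) = MonoidHom.id G →
          ∃ α' : CoordGroup (⇑(inclL (Y := Y)) '' S ∪ T) →* G,
            α'.comp (coordConst (⇑(inclL (Y := Y)) '' S ∪ T)) = MonoidHom.id G ∧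
            α'.comp (lamStar S T) = α) := by
  refine ⟨fun h => ⟨?_, fun α hα => ?_⟩, fun ⟨_, h⟩ U hU => ?_⟩
  · rw [injective_iff_map_eq_one]
    intro a
    obtain ⟨w, rfl⟩ := QuotientGroup.mk'_surjective (radical S) a
    intro hw
    have hmem : inclL w ∈ radical (⇑(inclL (Y := Y)) '' S ∪ T) :=
      (QuotientGroup.eq_one_iff _).1 hw
    refine (QuotientGroup.eq_one_iff w).2 fun U hU => ?_
    obtain ⟨B, hB⟩ := h U hU
    have hUB := hmem _ (isSolution_image_union hU hB)
    rwa [eval_inclL, Sum.elim_comp_inl] at hUB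
  · have hU := isSolution_of_comp_coordConst α hα
    obtain ⟨B, hB⟩ := h _ hU
    have hUB := isSolution_image_union hU hB
    refine ⟨coordEval _ _ hUB, coordEval_comp_coordConst hUB, MonoidHom.ext fun a => ?_⟩
    obtain ⟨w, rfl⟩ := QuotientGroup.mk'_surjective (radical S) a
    change eval _ (inclL w) = α (toCoord S w)
    rw [eval_inclL, Sum.elim_comp_inl, apply_toCoord α hα]
  · obtain ⟨α', hα', hext⟩ := h (coordEval S U hU) (coordEval_comp_coordConst hU)
    refine ⟨fun y => α' (toCoord _ (varg (Sum.inr y))), fun t ht => ?_⟩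
    have hsol := isSolution_of_comp_coordConst α' hα' t (Or.inr ht)
    convert hsol using 2
    congr 1
    funext z
    rcases z with x | y
    · have hx := DFunLike.congr_fun hext (toCoord S (varg x))
      rw [MonoidHom.comp_apply, lamStar_toCoord, inclL_varg, coordEval_toCoord, eval_varg] at hx
      exact hx.symm
    · rfl

end KM
end
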